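/- For a delineated abstract scattering representation of a non-lazy Markov transition matrix satisfying unbiased dynamical detailed balance, suppose additionally that whenever ω a c̃ > 0 there exists a state b in the common scattering class of a and c lying strictly between a and c in the class order. Then ω_{a,+} = ω_{a,−} = 1/2 for every state a; that is, the representation is balanced. -/

import Mathlib

open scoped BigOperators

namespace Scatter

variable {S : Type*}

/-- Infinite product over a subset, interpreted as the infimum of finite subproducts. -/
noncomputable def infProd (A : Set S) (f : S → ℝ) : ℝ :=
  ⨅ F : {F : Finset S // ↑F ⊆ A}, ∏ z ∈ F.1, f z

/-- An abstract scattering representation of a non-lazy Markov transition matrix,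
together with a fixed-point-free involution `inv` with `p a (inv a) = 0`. -/
structure Rep (S : Type*) where
  p : S → S → ℝ
  s : S → ℝ
  ω : S → S → ℝ
  inv : S → S
  p_nonneg : ∀ a b, 0 ≤ p a b
  p_rowSum : ∀ a, HasSum (p a) 1
  p_diag : ∀ a, p a a = 0
  s_pos : ∀ a, 0 < s a
  s_le_one : ∀ a, s a ≤ 1
  ω_nonneg : ∀ a b, 0 ≤ ω a b
  ω_le_one : ∀ a b, ω a b ≤ 1
  ω_diag : ∀ a, ω a a = 0
  p_eq : ∀ a b, p a b = ω a b * s b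
  inv_inv : ∀ a, inv (inv a) = a
  inv_ne : ∀ a, inv a ≠ a
  p_inv : ∀ a, p a (inv a) = 0

/-- Two states lie in the same scattering class: the equivalence relation generated by
relating `a` and `b` whenever `ω a (inv b) > 0` or `ω b (inv a) > 0`. -/
def Rep.same (R : Rep S) : S → S → Prop :=
  Relation.EqvGen fun a b => 0 < R.ω a (R.inv b) ∨ 0 < R.ω b (R.inv a)

/-- A delineation: a strict order which is a linear order on each scattering class,
compatible with the scattering representation. -/
structure Delineation (R : Rep S) where
  lt : S → S → Prop
  irrefl : ∀ a, ¬ lt a a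
  trans : ∀ a b c, lt a b → lt b c → lt a c
  total : ∀ a b, R.same a b → a = b ∨ lt a b ∨ lt b a
  compat_sum : ∀ a b c, R.same a b → R.same b c → lt a b → lt b c →
    R.ω b (R.inv a) + R.ω b (R.inv c) ≤ 1
  compat_mono : ∀ a b c, R.same a b → R.same b c →
    ((lt a b ∧ lt b c) ∨ (lt c b ∧ lt b a)) →
    R.ω a (R.inv c) ≤ R.ω a (R.inv b) * (1 - R.s (R.inv b))

/-- Limiting transmission probability in the `+` direction. -/
noncomputable def Delineation.ωplus {R : Rep S} (D : Delineation R) (a : S) : ℝ :=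
  sSup {x | ∃ b, R.same a b ∧ D.lt a b ∧ x = R.ω a (R.inv b)}

/-- Limiting transmission probability in the `−` direction. -/
noncomputable def Delineation.ωminus {R : Rep S} (D : Delineation R) (a : S) : ℝ :=
  sSup {x | ∃ b, R.same a b ∧ D.lt b a ∧ x = R.ω a (R.inv b)}

/-- Dynamical detailed balance with invariant measure `π`. -/
structure DetailedBalance (R : Rep S) where
  π : S → ℝ
  π_pos : ∀ a, 0 < π a
  π_inv : ∀ a, π (R.inv a) = π a
  balance : ∀ a b, π a * R.p a (R.inv b) = π b * R.p b (R.inv a)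

/-- Unbiasedness of the scattering representation. -/
def Rep.Unbiased (R : Rep S) : Prop :=
  ∀ a b, R.ω a (R.inv b) = R.ω b (R.inv a)

end Scatter

namespace Scatter

theorem exists_max_aux {S : Type*} (lt : S → S → Prop) (T : Set S)
    (htr : ∀ a b c, lt a b → lt b c → lt a c)
    (htot : ∀ a ∈ T, ∀ b ∈ T, a = b ∨ lt a b ∨ lt b a) (F : Finset S) :
    (∀ z ∈ F, z ∈ T) → F.Nonempty → ∃ m ∈ F, ∀ z ∈ F, z = m ∨ lt z m := by
  classical
  induction F using Finset.induction_on with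
  | empty => intro _ h; simp at h
  | insert x F hx ih =>
    intro hT _
    by_cases hF : F.Nonempty
    · obtain ⟨m, hm, hmax⟩ := ih (fun z hz => hT z (Finset.mem_insert_of_mem hz)) hF
      rcases htot x (hT x (Finset.mem_insert_self _ _)) m (hT m (Finset.mem_insert_of_mem hm))
        with h | h | h
      · exact absurd (h ▸ hm) hx
      · refine ⟨m, Finset.mem_insert_of_mem hm, fun z hz => ?_⟩
        rcases Finset.mem_insert.1 hz with rfl | hz
        · exact Or.inr h
        · exact hmax z hz
      · refine ⟨x, Finset.mem_insert_self _ _, fun z hz => ?_⟩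
        rcases Finset.mem_insert.1 hz with rfl | hz
        · exact Or.inl rfl
        · rcases hmax z hz with rfl | h'
          · exact Or.inr h
          · exact Or.inr (htr _ _ _ h' h)
    · rw [Finset.not_nonempty_iff_eq_empty] at hF
      subst hF
      exact ⟨x, by simp, by simp⟩

theorem chain_aux {S : Type*} (lt : S → S → Prop) (T : Set S) (f t : S → ℝ) (W : ℝ)
    (htr : ∀ a b c, lt a b → lt b c → lt a c)
    (htot : ∀ a ∈ T, ∀ b ∈ T, a = b ∨ lt a b ∨ lt b a)
    (ht0 : ∀ a, 0 < t a) (ht1 : ∀ a, t a ≤ 1)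
    (hmono : ∀ b ∈ T, ∀ c ∈ T, lt b c → f c ≤ f b * (1 - t b))
    (hW : ∀ b ∈ T, f b ≤ W) (n : ℕ) :
    ∀ F : Finset S, F.card = n → (∀ z ∈ F, z ∈ T) →
      (∑ z ∈ F, f z * t z ≤ W * (1 - ∏ z ∈ F, (1 - t z))) ∧
      (∀ c ∈ T, (∀ z ∈ F, lt z c) → f c ≤ W * ∏ z ∈ F, (1 - t z)) := by
  classical
  induction n with
  | zero =>
    intro F hF _
    rw [Finset.card_eq_zero] at hF
    subst hF
    simp
    exact hW
  | succ n ih =>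
    intro F hF hT
    obtain ⟨m, hm, hmax⟩ := exists_max_aux lt T htr htot F hT (Finset.card_pos.1 (by omega))
    have hc : (F.erase m).card = n := by rw [Finset.card_erase_of_mem hm]; omega
    obtain ⟨h1, h2⟩ := ih (F.erase m) hc (fun z hz => hT z (Finset.mem_of_mem_erase hz))
    have hfm := h2 m (hT m hm) (fun z hz => by
      rcases hmax z (Finset.mem_of_mem_erase hz) with h | h
      · exact absurd h (Finset.ne_of_mem_erase hz)
      · exact h)
    rw [← Finset.mul_prod_erase F _ hm, ← Finset.add_sum_erase F _ hm]
    have a0 := ht0 m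
    have a1 := ht1 m
    constructor
    · nlinarith
    · intro c hcT hcF
      have := hmono m (hT m hm) c hcT (hcF m hm)
      nlinarith

variable {S : Type*}

theorem Rep.same_refl (R : Rep S) (a : S) : R.same a a := Relation.EqvGen.refl a
theorem Rep.same_symm (R : Rep S) {a b : S} (h : R.same a b) : R.same b a :=
  Relation.EqvGen.symm _ _ h
theorem Rep.same_trans (R : Rep S) {a b c : S} (h : R.same a b) (h' : R.same b c) :
    R.same a c := Relation.EqvGen.trans _ _ _ h h'
theorem Rep.same_of_pos (R : Rep S) {a b : S} (h : 0 < R.ω a (R.inv b)) : R.same a b :=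
  Relation.EqvGen.rel _ _ (Or.inl h)

theorem Rep.ω_inv (R : Rep S) (a : S) : R.ω a (R.inv a) = 0 := by
  have h := R.p_inv a
  rw [R.p_eq] at h
  exact (mul_eq_zero.1 h).resolve_right (R.s_pos _).ne'

def Delineation.flip {R : Rep S} (D : Delineation R) : Delineation R where
  lt a b := D.lt b a
  irrefl := D.irrefl
  trans a b c h h' := D.trans _ _ _ h' h
  total a b h := by
    rcases D.total a b h with h | h | h
    · exact Or.inl h
    · exact Or.inr (Or.inr h)
    · exact Or.inr (Or.inl h)
  compat_sum a b c h h' l l' := by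
    have := D.compat_sum c b a (R.same_symm h') (R.same_symm h) l' l
    linarith
  compat_mono a b c h h' l := D.compat_mono a b c h h' (l.symm.imp And.symm And.symm)

theorem Delineation.flip_plus {R : Rep S} (D : Delineation R) (a : S) :
    D.flip.ωplus a = D.ωminus a := rfl
theorem Delineation.flip_minus {R : Rep S} (D : Delineation R) (a : S) :
    D.flip.ωminus a = D.ωplus a := rfl

theorem Delineation.le_plus {R : Rep S} (D : Delineation R) {a b : S} (h : R.same a b)
    (l : D.lt a b) : R.ω a (R.inv b) ≤ D.ωplus a := by
  apply le_csSup
  · refine ⟨1, ?_⟩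
    rintro x ⟨b, _, _, rfl⟩
    exact R.ω_le_one _ _
  · exact ⟨b, h, l, rfl⟩

theorem Delineation.plus_nonneg {R : Rep S} (D : Delineation R) (a : S) : 0 ≤ D.ωplus a := by
  apply Real.sSup_nonneg
  rintro x ⟨b, _, _, rfl⟩
  exact R.ω_nonneg _ _

theorem Delineation.plus_le_of {R : Rep S} (D : Delineation R) (a : S) (x : ℝ) (hx : 0 ≤ x)
    (h : ∀ b, R.same a b → D.lt a b → R.ω a (R.inv b) ≤ x) : D.ωplus a ≤ x := by
  apply Real.sSup_le _ hx
  rintro y ⟨b, h1, h2, rfl⟩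
  exact h b h1 h2

theorem Delineation.add_le_one {R : Rep S} (D : Delineation R) (a : S) :
    D.ωplus a + D.ωminus a ≤ 1 := by
  have hm : D.ωminus a ≤ 1 := by
    rw [← D.flip_plus]
    exact D.flip.plus_le_of a 1 zero_le_one (fun b _ _ => R.ω_le_one _ _)
  have : D.ωplus a ≤ 1 - D.ωminus a := by
    apply D.plus_le_of a _ (by linarith)
    intro b hb lb
    have : D.ωminus a ≤ 1 - R.ω a (R.inv b) := by
      rw [← D.flip_plus]
      apply D.flip.plus_le_of a _ (by linarith [R.ω_le_one a (R.inv b)])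
      intro c hc lc
      have := D.compat_sum c a b (R.same_symm hc) hb lc lb
      linarith
    linarith
  linarith

/-- The chain bound for the states above `a`. -/
theorem Delineation.chain {R : Rep S} (D : Delineation R) (a : S) (F : Finset S)
    (P : S → Prop) (W : ℝ)
    (hW : ∀ b, R.same a b → D.lt a b → P b → R.ω a (R.inv b) ≤ W)
    (hF : ∀ z ∈ F, R.same a z ∧ D.lt a z ∧ P z) :
      (∑ z ∈ F, R.ω a (R.inv z) * R.s (R.inv z) ≤ W * (1 - ∏ z ∈ F, (1 - R.s (R.inv z)))) ∧
      (∀ c, R.same a c → D.lt a c → P c → (∀ z ∈ F, D.lt z c) →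
        R.ω a (R.inv c) ≤ W * ∏ z ∈ F, (1 - R.s (R.inv z))) := by
  have := chain_aux D.lt {z | R.same a z ∧ D.lt a z ∧ P z} (fun z => R.ω a (R.inv z))
    (fun z => R.s (R.inv z)) W D.trans
    (fun x hx y hy => D.total x y (R.same_trans (R.same_symm hx.1) hy.1))
    (fun _ => R.s_pos _) (fun _ => R.s_le_one _)
    (fun b hb c hc l => D.compat_mono a b c hb.1 (R.same_trans (R.same_symm hb.1) hc.1)
      (Or.inl ⟨hb.2.1, l⟩))
    (fun b hb => hW b hb.1 hb.2.1 hb.2.2) F.card F rfl hF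
  exact ⟨this.1, fun c h1 h2 h3 => this.2 c ⟨h1, h2, h3⟩⟩

theorem prod_nonneg_aux (R : Rep S) (F : Finset S) : 0 ≤ ∏ z ∈ F, (1 - R.s (R.inv z)) :=
  Finset.prod_nonneg (fun z _ => by linarith [R.s_le_one (R.inv z)])

theorem Delineation.sum_le {R : Rep S} (D : Delineation R) (a : S) (F : Finset S)
    (P : S → Prop) (W : ℝ) (hW0 : 0 ≤ W)
    (hW : ∀ b, R.same a b → D.lt a b → P b → R.ω a (R.inv b) ≤ W)
    (hF : ∀ z ∈ F, R.same a z ∧ D.lt a z ∧ P z) :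
      ∑ z ∈ F, R.ω a (R.inv z) * R.s (R.inv z) ≤ W := by
  have := (D.chain a F P W hW hF).1
  have := mul_nonneg hW0 (prod_nonneg_aux R F)
  linarith

theorem Rep.hasSum_inv (R : Rep S) (a : S) :
    HasSum (fun z => R.ω a (R.inv z) * R.s (R.inv z)) 1 := by
  have h := (Equiv.hasSum_iff (f := R.p a) (a := 1)
    (⟨R.inv, R.inv, R.inv_inv, R.inv_inv⟩ : S ≃ S)).2 (R.p_rowSum a)
  convert h using 2 with z
  exact (R.p_eq _ _).symm

theorem Delineation.exists_split {R : Rep S} (D : Delineation R) (a : S) (ε : ℝ) (hε : 0 < ε) :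
    ∃ F G : Finset S, (∀ z ∈ F, R.same a z ∧ D.lt a z) ∧ (∀ z ∈ G, R.same a z ∧ D.lt z a) ∧
      1 - ε < ∑ z ∈ F, R.ω a (R.inv z) * R.s (R.inv z)
        + ∑ z ∈ G, R.ω a (R.inv z) * R.s (R.inv z) := by
  classical
  have h := (R.hasSum_inv a).eventually_const_lt (show 1 - ε < 1 by linarith)
  obtain ⟨H, hH⟩ := h.exists
  refine ⟨H.filter (fun z => R.same a z ∧ D.lt a z), H.filter (fun z => R.same a z ∧ D.lt z a),
    fun z hz => (Finset.mem_filter.1 hz).2, fun z hz => (Finset.mem_filter.1 hz).2,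
    lt_of_lt_of_le hH ?_⟩
  rw [Finset.sum_filter, Finset.sum_filter, ← Finset.sum_add_distrib]
  apply Finset.sum_le_sum
  intro z _
  have hn : 0 ≤ R.ω a (R.inv z) * R.s (R.inv z) :=
    mul_nonneg (R.ω_nonneg _ _) (R.s_pos _).le
  rcases (R.ω_nonneg a (R.inv z)).eq_or_lt with h0 | h0
  · rw [← h0]; simp
  · have hs := R.same_of_pos h0
    rcases D.total a z hs with rfl | h | h
    · rw [R.ω_inv] at h0; exact absurd h0 (lt_irrefl _)
    · rw [if_pos ⟨hs, h⟩]; split_ifs <;> linarith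
    · rw [if_pos (⟨hs, h⟩ : R.same a z ∧ D.lt z a)]; split_ifs <;> linarith

theorem Delineation.exists_plus {R : Rep S} (D : Delineation R) (a : S) (ε : ℝ) (hε : 0 < ε) :
    ∃ F : Finset S, (∀ z ∈ F, R.same a z ∧ D.lt a z) ∧
      1 - ε - D.ωminus a < ∑ z ∈ F, R.ω a (R.inv z) * R.s (R.inv z) := by
  obtain ⟨F, G, hF, hG, h⟩ := D.exists_split a ε hε
  refine ⟨F, hF, ?_⟩
  have := D.flip.sum_le a G (fun _ => True) (D.flip.ωplus a) (D.flip.plus_nonneg a)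
    (fun b h l _ => D.flip.le_plus h l) (fun z hz => ⟨(hG z hz).1, (hG z hz).2, trivial⟩)
  rw [D.flip_plus] at this
  linarith

theorem Delineation.add_eq_one {R : Rep S} (D : Delineation R) (a : S) :
    D.ωplus a + D.ωminus a = 1 := by
  refine le_antisymm (D.add_le_one a) (le_of_forall_pos_le_add fun ε hε => ?_)
  obtain ⟨F, hF, h⟩ := D.exists_plus a ε hε
  have := D.sum_le a F (fun _ => True) (D.ωplus a) (D.plus_nonneg a)
    (fun b h l _ => D.le_plus h l) (fun z hz => ⟨(hF z hz).1, (hF z hz).2, trivial⟩)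
  linarith

theorem Delineation.exists_prod {R : Rep S} (D : Delineation R) (a c : S) (hs : R.same a c)
    (hl : D.lt a c) (ε : ℝ) (hε : 0 < ε) :
    ∃ F : Finset S, (∀ z ∈ F, R.same a z ∧ D.lt a z ∧ D.lt z c) ∧
      D.ωplus a * ∏ z ∈ F, (1 - R.s (R.inv z)) ≤ R.ω a (R.inv c) + ε := by
  classical
  obtain ⟨F, hF, h⟩ := D.exists_plus a ε hε
  have hone := D.add_eq_one a
  have h1 : ∀ z ∈ F.filter (fun z => D.lt z c), R.same a z ∧ D.lt a z ∧ D.lt z c := by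
    intro z hz
    obtain ⟨hz, hzc⟩ := Finset.mem_filter.1 hz
    exact ⟨(hF z hz).1, (hF z hz).2, hzc⟩
  refine ⟨F.filter (fun z => D.lt z c), h1, ?_⟩
  have hA := (D.chain a _ (fun z => D.lt z c) (D.ωplus a) (fun b h l _ => D.le_plus h l) h1).1
  have hB := D.sum_le a (F.filter (fun z => ¬ D.lt z c)) (fun z => ¬ D.lt z c)
    (R.ω a (R.inv c)) (R.ω_nonneg _ _)
    (fun b hb lb hn => by
      rcases D.total b c (R.same_trans (R.same_symm hb) hs) with rfl | h | h
      · exact le_rfl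
      · exact absurd h hn
      · have := D.compat_mono a c b hs (R.same_trans (R.same_symm hs) hb) (Or.inl ⟨hl, h⟩)
        nlinarith [R.ω_nonneg a (R.inv c), R.s_pos (R.inv c)])
    (fun z hz => by
      obtain ⟨hz, hzc⟩ := Finset.mem_filter.1 hz
      exact ⟨(hF z hz).1, (hF z hz).2, hzc⟩)
  have hsum := Finset.sum_filter_add_sum_filter_not F (fun z => D.lt z c)
    (fun z => R.ω a (R.inv z) * R.s (R.inv z))
  linarith

theorem Delineation.plus_le_minus {R : Rep S} (D : Delineation R) (hub : R.Unbiased) (a c : S)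
    (hw : 0 < R.ω a (R.inv c)) (hl : D.lt a c) : D.ωplus a ≤ D.ωminus c := by
  have hs := R.same_of_pos hw
  have hC : 0 ≤ D.ωminus c := D.flip.plus_nonneg c
  have hC1 : D.ωminus c ≤ 1 := by linarith [D.add_le_one c, D.plus_nonneg c]
  have hA : 0 ≤ D.ωplus a := D.plus_nonneg a
  have key : D.ωplus a * R.ω a (R.inv c) ≤ D.ωminus c * R.ω a (R.inv c) := by
    refine le_of_forall_pos_le_add fun ε hε => ?_
    obtain ⟨F, hF, h⟩ := D.exists_prod a c hs hl ε hε
    have h2 := (D.flip.chain c F (fun _ => True) (D.flip.ωplus c)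
      (fun b h l _ => D.flip.le_plus h l)
      (fun z hz => ⟨R.same_trans (R.same_symm hs) (hF z hz).1, (hF z hz).2.2, trivial⟩)).2 a
      (R.same_symm hs) hl trivial (fun z hz => (hF z hz).2.1)
    rw [D.flip_plus, ← hub a c] at h2
    have e1 := mul_le_mul_of_nonneg_left h2 hA
    have e2 := mul_le_mul_of_nonneg_left h hC
    have e3 : D.ωminus c * ε ≤ ε := by nlinarith
    nlinarith
  exact le_of_mul_le_mul_right key hw

theorem Delineation.plus_eq_minus {R : Rep S} (D : Delineation R) (hub : R.Unbiased) (a c : S)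
    (hw : 0 < R.ω a (R.inv c)) (hl : D.lt a c) : D.ωplus a = D.ωminus c :=
  le_antisymm (D.plus_le_minus hub a c hw hl)
    (D.flip.plus_le_minus hub c a (by rw [← hub a c]; exact hw) hl)

theorem Delineation.plus_half {R : Rep S} (D : Delineation R) (hub : R.Unbiased)
    (hbetween : ∀ a c, 0 < R.ω a (R.inv c) →
      ∃ b, R.same a b ∧ ((D.lt a b ∧ D.lt b c) ∨ (D.lt c b ∧ D.lt b a))) (a c : S)
    (hw : 0 < R.ω a (R.inv c)) (hl : D.lt a c) : D.ωplus a = 1 / 2 := by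
  have hs := R.same_of_pos hw
  obtain ⟨b, hb, h | h⟩ := hbetween a c hw
  · have hbc := R.same_trans (R.same_symm hb) hs
    have m1 := D.compat_mono a b c hb hbc (Or.inl h)
    have m2 := D.compat_mono c b a (R.same_symm hbc) (R.same_symm hb) (Or.inr h)
    rw [← hub a c] at m2
    have s0 := R.s_pos (R.inv b)
    have p1 : 0 < R.ω a (R.inv b) := by
      nlinarith [R.ω_nonneg a (R.inv b)]
    have p2 : 0 < R.ω b (R.inv c) := by
      rw [hub b c]
      nlinarith [R.ω_nonneg c (R.inv b)]
    have e1 := D.plus_eq_minus hub a b p1 h.1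
    have e2 := D.plus_eq_minus hub b c p2 h.2
    have e3 := D.plus_eq_minus hub a c hw hl
    have := D.add_eq_one b
    linarith
  · exact absurd (D.trans _ _ _ hl (D.trans _ _ _ h.1 h.2)) (D.irrefl a)

end Scatter

/-- Corollary `cor:symmetry2`: for a delineated scattering representation
satisfying unbiased dynamical detailed balance, if whenever `ω a c̃ > 0` there is a state
strictly between `a` and `c` in the common scattering class, then the representation is
balanced: `ω_{a,+} = ω_{a,−} = 1/2` for every state `a`. -/
theorem stmt7 {S : Type*} [Countable S] (R : Scatter.Rep S) (D : Scatter.Delineation R)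
    (DB : Scatter.DetailedBalance R) (hub : R.Unbiased)
    (hbetween : ∀ a c, 0 < R.ω a (R.inv c) →
      ∃ b, R.same a b ∧ ((D.lt a b ∧ D.lt b c) ∨ (D.lt c b ∧ D.lt b a))) :
    ∀ a, D.ωplus a = 1 / 2 ∧ D.ωminus a = 1 / 2 := by
  intro a
  have hone := D.add_eq_one a
  have hex : ∃ c, 0 < R.ω a (R.inv c) := by
    by_contra! h
    have h0 : (fun z => R.ω a (R.inv z) * R.s (R.inv z)) = fun _ => 0 := by
      funext z
      rw [le_antisymm (h z) (R.ω_nonneg _ _), zero_mul]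
    have h1 := R.hasSum_inv a
    rw [h0] at h1
    exact zero_ne_one (hasSum_zero.unique h1)
  obtain ⟨c, hc⟩ := hex
  rcases D.total a c (R.same_of_pos hc) with rfl | h | h
  · rw [R.ω_inv] at hc
    exact absurd hc (lt_irrefl _)
  · have := D.plus_half hub hbetween a c hc h
    constructor <;> linarith
  · have := D.flip.plus_half hub (fun a c h => by
      obtain ⟨b, hb, h⟩ := hbetween a c h
      exact ⟨b, hb, h.symm.imp And.symm And.symm⟩) a c hc h
    rw [D.flip_plus] at this
    constructor <;> linarith
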